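/- Let $A \in \mathbb{R}^{n\times n}$, $\Sigma = \mathrm{diag}(\sigma_1,\dots,\sigma_n)$ with $\sigma_1 \ge \dots \ge \sigma_n > 0$, and suppose $A\Sigma + \Sigma A^T = -BB^T$ and $A^T\Sigma + \Sigma A = -C^TC$ (balanced realization) with $A$ asymptotically stable. Partition $A = \begin{pmatrix} A_{11} & A_{12} \\ A_{21} & A_{22} \end{pmatrix}$ conformally with $\Sigma = \mathrm{diag}(\Sigma_1, \Sigma_2)$, $\Sigma_1 \in \mathbb{R}^{r\times r}$, and assume $\sigma_r \ne \sigma_{r+1}$. Then $A_{11}$ and $A_{22}$ are asymptotically stable. -/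

import Mathlib

open Matrix

/-- A real square matrix is (asymptotically) stable if every complex eigenvalue has
negative real part. -/
def IsStable {ι : Type*} [Fintype ι] [DecidableEq ι] (A : Matrix ι ι ℝ) : Prop :=
  ∀ μ ∈ spectrum ℂ (A.map (algebraMap ℝ ℂ)), μ.re < 0

section Helpers

variable {ι κ α β : Type*} [Fintype ι] [DecidableEq ι] [Fintype κ] [DecidableEq κ]
  [Fintype α] [Fintype β]

/-- The diagonal complex matrix with real entries. -/
noncomputable def cdiag {ι : Type*} [DecidableEq ι] (s : ι → ℝ) : Matrix ι ι ℂ :=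
  Matrix.diagonal (fun i => (s i : ℂ))

/-- Energy identity. -/
theorem energy (A : Matrix ι ι ℂ) (C : Matrix α ι ℂ) (s : ι → ℝ)
    (h : Aᴴ * cdiag s + cdiag s * A = -(Cᴴ * C)) (v : ι → ℂ) (μ : ℂ)
    (hv : A *ᵥ v = μ • v) :
    2 * μ.re * ∑ i, s i * Complex.normSq (v i) = - ∑ a, Complex.normSq ((C *ᵥ v) a) := by
  have h1 : star v ⬝ᵥ ((Aᴴ * cdiag s + cdiag s * A) *ᵥ v) = star v ⬝ᵥ ((-(Cᴴ * C)) *ᵥ v) := by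
    rw [h]
  have e1 : star v ⬝ᵥ ((Aᴴ * cdiag s) *ᵥ v) = star μ * (star v ⬝ᵥ (cdiag s *ᵥ v)) := by
    rw [← mulVec_mulVec, dotProduct_mulVec, ← star_mulVec, hv, star_smul, smul_dotProduct,
      smul_eq_mul]
  have e2 : star v ⬝ᵥ ((cdiag s * A) *ᵥ v) = μ * (star v ⬝ᵥ (cdiag s *ᵥ v)) := by
    rw [← mulVec_mulVec, hv, mulVec_smul, dotProduct_smul, smul_eq_mul]
  have e3 : star v ⬝ᵥ ((-(Cᴴ * C)) *ᵥ v) = -(star (C *ᵥ v) ⬝ᵥ (C *ᵥ v)) := by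
    rw [neg_mulVec, dotProduct_neg, ← mulVec_mulVec, dotProduct_mulVec, ← star_mulVec]
  have e4 : star v ⬝ᵥ (cdiag s *ᵥ v) = ((∑ i, s i * Complex.normSq (v i) : ℝ) : ℂ) := by
    simp only [dotProduct, cdiag, mulVec_diagonal, Pi.star_apply]
    push_cast
    refine Finset.sum_congr rfl fun i _ => ?_
    rw [Complex.normSq_eq_conj_mul_self]
    simp only [RCLike.star_def]
    ring
  have e5 : star (C *ᵥ v) ⬝ᵥ (C *ᵥ v) = ((∑ a, Complex.normSq ((C *ᵥ v) a) : ℝ) : ℂ) := by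
    simp only [dotProduct, Pi.star_apply]
    push_cast
    refine Finset.sum_congr rfl fun i _ => ?_
    rw [Complex.normSq_eq_conj_mul_self]
    simp only [RCLike.star_def]
  rw [add_mulVec, dotProduct_add, e1, e2, e3, e4, e5] at h1
  have h2 := congrArg Complex.re h1
  simp only [RCLike.star_def, Complex.add_re, Complex.neg_re, Complex.re_mul_ofReal,
    Complex.conj_re, Complex.ofReal_re] at h2
  linarith

theorem output_zero (A : Matrix ι ι ℂ) (C : Matrix α ι ℂ) (s : ι → ℝ)
    (h : Aᴴ * cdiag s + cdiag s * A = -(Cᴴ * C)) (v : ι → ℂ) (μ : ℂ)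
    (hv : A *ᵥ v = μ • v) (hμ : μ.re = 0) : C *ᵥ v = 0 := by
  have e := energy A C s h v μ hv
  rw [hμ] at e
  have e' : ∑ a, Complex.normSq ((C *ᵥ v) a) = 0 := by linarith
  rw [Finset.sum_eq_zero_iff_of_nonneg (fun _ _ => Complex.normSq_nonneg _)] at e'
  funext a
  exact Complex.normSq_eq_zero.1 (e' a (Finset.mem_univ a))

theorem re_zero (A : Matrix ι ι ℂ) (C : Matrix α ι ℂ) (s : ι → ℝ) (hs : ∀ i, 0 < s i)
    (h : Aᴴ * cdiag s + cdiag s * A = -(Cᴴ * C)) (v : ι → ℂ) (μ : ℂ)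
    (hv : A *ᵥ v = μ • v) (hv0 : v ≠ 0) (hμ : 0 ≤ μ.re) : μ.re = 0 := by
  have e := energy A C s h v μ hv
  have hT : 0 ≤ ∑ a, Complex.normSq ((C *ᵥ v) a) :=
    Finset.sum_nonneg fun _ _ => Complex.normSq_nonneg _
  have hS : 0 < ∑ i, s i * Complex.normSq (v i) := by
    obtain ⟨i, hi⟩ := Function.ne_iff.1 hv0
    exact Finset.sum_pos' (fun j _ => mul_nonneg (hs j).le (Complex.normSq_nonneg _))
      ⟨i, Finset.mem_univ i, mul_pos (hs i) (Complex.normSq_pos.2 hi)⟩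
  by_contra hne
  have : 0 < μ.re := lt_of_le_of_ne hμ (Ne.symm hne)
  have := mul_pos this hS
  linarith

theorem step (A : Matrix ι ι ℂ) (A12 : Matrix ι κ ℂ) (A21 : Matrix κ ι ℂ)
    (B1 : Matrix ι β ℂ) (B2 : Matrix κ β ℂ) (C1 : Matrix α ι ℂ) (C2 : Matrix α κ ℂ)
    (s : ι → ℝ) (t : κ → ℝ)
    (R11 : A * cdiag s + cdiag s * Aᴴ = -(B1 * B1ᴴ))
    (R21 : A21 * cdiag s + cdiag t * A12ᴴ = -(B2 * B1ᴴ))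
    (O11 : Aᴴ * cdiag s + cdiag s * A = -(C1ᴴ * C1))
    (O21 : A12ᴴ * cdiag s + cdiag t * A21 = -(C2ᴴ * C1))
    (v : ι → ℂ) (μ : ℂ) (hμ : μ.re = 0) (hv : A *ᵥ v = μ • v) :
    A *ᵥ (cdiag s *ᵥ (cdiag s *ᵥ v)) = μ • (cdiag s *ᵥ (cdiag s *ᵥ v)) ∧
    A21 *ᵥ (cdiag s *ᵥ (cdiag s *ᵥ v)) = cdiag t *ᵥ (cdiag t *ᵥ (A21 *ᵥ v)) := by
  have hC := output_zero A C1 s O11 v μ hv hμ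
  have o1 := congrArg (fun M => M *ᵥ v) O11
  have o2 := congrArg (fun M => M *ᵥ v) O21
  simp only [add_mulVec, neg_mulVec, ← mulVec_mulVec, hC, mulVec_zero, neg_zero, hv,
    mulVec_smul] at o1 o2
  set w := cdiag s *ᵥ v with hw
  have hw1 : Aᴴ *ᵥ w = (-μ) • w := by
    rw [neg_smul]; exact eq_neg_of_add_eq_zero_left o1
  have hB := output_zero Aᴴ B1ᴴ s (by simpa using R11) w (-μ) hw1 (by simp [hμ])
  have r1 := congrArg (fun M => M *ᵥ w) R11
  have r2 := congrArg (fun M => M *ᵥ w) R21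
  simp only [add_mulVec, neg_mulVec, ← mulVec_mulVec, hB, mulVec_zero, neg_zero, hw1,
    mulVec_neg, mulVec_smul, neg_smul] at r1 r2
  refine ⟨?_, ?_⟩
  · exact add_neg_eq_zero.1 r1
  · have := eq_neg_of_add_eq_zero_left o2
    rw [this, mulVec_neg] at r2
    exact add_neg_eq_zero.1 r2

theorem core (A : Matrix ι ι ℂ) (A12 : Matrix ι κ ℂ) (A21 : Matrix κ ι ℂ)
    (B1 : Matrix ι β ℂ) (B2 : Matrix κ β ℂ) (C1 : Matrix α ι ℂ) (C2 : Matrix α κ ℂ)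
    (s : ι → ℝ) (t : κ → ℝ) (hs : ∀ i, 0 < s i) (ht : ∀ i, 0 < t i) (hst : ∀ i j, s i ≠ t j)
    (R11 : A * cdiag s + cdiag s * Aᴴ = -(B1 * B1ᴴ))
    (R21 : A21 * cdiag s + cdiag t * A12ᴴ = -(B2 * B1ᴴ))
    (O11 : Aᴴ * cdiag s + cdiag s * A = -(C1ᴴ * C1))
    (O21 : A12ᴴ * cdiag s + cdiag t * A21 = -(C2ᴴ * C1))
    (v : ι → ℂ) (μ : ℂ) (hv0 : v ≠ 0) (hv : A *ᵥ v = μ • v) 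
    (hA : A21 *ᵥ v = 0 → μ.re < 0) : μ.re < 0 := by
  by_contra hneg
  have hμ := re_zero A C1 s hs O11 v μ hv hv0 (not_lt.1 hneg)
  apply hneg
  apply hA
  have key : ∀ S : Finset ι, ∃ w : ι → ℂ, A *ᵥ w = μ • w ∧
      (∀ j, w j = (∏ i ∈ S, ((s j : ℂ) ^ 2 - (s i : ℂ) ^ 2)) * v j) ∧
      (∀ j, (A21 *ᵥ w) j = (∏ i ∈ S, ((t j : ℂ) ^ 2 - (s i : ℂ) ^ 2)) * (A21 *ᵥ v) j) := by
    intro S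
    induction S using Finset.induction_on with
    | empty => exact ⟨v, hv, by simp, by simp⟩
    | insert a S ha ih =>
      obtain ⟨w, h1, h2, h3⟩ := ih
      obtain ⟨g1, g2⟩ := step A A12 A21 B1 B2 C1 C2 s t R11 R21 O11 O21 w μ hμ h1
      refine ⟨cdiag s *ᵥ (cdiag s *ᵥ w) - ((s a : ℂ) ^ 2) • w, ?_, ?_, ?_⟩
      · rw [mulVec_sub, g1, mulVec_smul, h1, smul_sub, smul_comm]
      · intro j
        rw [Finset.prod_insert ha]
        simp only [cdiag, Pi.sub_apply, mulVec_diagonal, Pi.smul_apply, smul_eq_mul, h2]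
        ring
      · intro j
        rw [Finset.prod_insert ha, mulVec_sub, g2, mulVec_smul]
        simp only [cdiag, Pi.sub_apply, mulVec_diagonal, Pi.smul_apply, smul_eq_mul, h3]
        ring
  obtain ⟨w, -, h2, h3⟩ := key Finset.univ
  have hw : w = 0 := by
    funext j
    rw [h2, Finset.prod_eq_zero (Finset.mem_univ j) (sub_self _), zero_mul]; rfl
  funext j
  have := h3 j
  rw [hw, mulVec_zero] at this
  rcases mul_eq_zero.1 this.symm with h | h
  · exfalso
    obtain ⟨i, -, hi⟩ := Finset.prod_eq_zero_iff.1 h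
    have : (t j) ^ 2 = (s i) ^ 2 := by exact_mod_cast sub_eq_zero.1 hi
    exact hst i j ((sq_eq_sq₀ (ht j).le (hs i).le).1 this).symm
  · exact h

theorem mem_spec (A : Matrix ι ι ℂ) (μ : ℂ) :
    μ ∈ spectrum ℂ A ↔ ∃ v, v ≠ 0 ∧ A *ᵥ v = μ • v := by
  rw [← Matrix.spectrum_toLin', ← Module.End.hasEigenvalue_iff_mem_spectrum]
  constructor
  · intro h
    obtain ⟨v, hv⟩ := h.exists_hasEigenvector
    exact ⟨v, hv.2, by simpa using hv.apply_eq_smul⟩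
  · rintro ⟨v, h0, h⟩
    exact Module.End.hasEigenvalue_of_hasEigenvector
      (x := v) ⟨Module.End.mem_eigenspace_iff.2 (by simpa using h), h0⟩

theorem mapC_conj {m n : Type*} (M : Matrix m n ℝ) :
    (Mᵀ).map (algebraMap ℝ ℂ) = (M.map (algebraMap ℝ ℂ))ᴴ := by
  ext i j; simp

theorem mapC_diag (s : ι → ℝ) : (Matrix.diagonal s).map (algebraMap ℝ ℂ) = cdiag s := by
  rw [cdiag, Matrix.diagonal_map (map_zero _)]; rfl

theorem mapC_eq {m n l q : Type*} [Fintype l] [Fintype q] [Fintype m] [Fintype n] {κ : Type*} [Fintype κ]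
    (X : Matrix m l ℝ) (Y : Matrix l n ℝ) (Z : Matrix m q ℝ) (W : Matrix q n ℝ)
    (U : Matrix m κ ℝ) (V : Matrix κ n ℝ) (h : X * Y + Z * W = -(U * V)) :
    X.map (algebraMap ℝ ℂ) * Y.map (algebraMap ℝ ℂ) + Z.map (algebraMap ℝ ℂ) * W.map (algebraMap ℝ ℂ)
      = -(U.map (algebraMap ℝ ℂ) * V.map (algebraMap ℝ ℂ)) := by
  rw [← Matrix.map_mul, ← Matrix.map_mul, ← Matrix.map_mul, ← Matrix.map_add _ (map_add _), h]
  ext i j; simp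

theorem coreR (A : Matrix ι ι ℝ) (A12 : Matrix ι κ ℝ) (A21 : Matrix κ ι ℝ)
    (B1 : Matrix ι β ℝ) (B2 : Matrix κ β ℝ) (C1 : Matrix α ι ℝ) (C2 : Matrix α κ ℝ)
    (s : ι → ℝ) (t : κ → ℝ) (hs : ∀ i, 0 < s i) (ht : ∀ i, 0 < t i) (hst : ∀ i j, s i ≠ t j)
    (R11 : A * diagonal s + diagonal s * Aᵀ = -(B1 * B1ᵀ))
    (R21 : A21 * diagonal s + diagonal t * A12ᵀ = -(B2 * B1ᵀ))
    (O11 : Aᵀ * diagonal s + diagonal s * A = -(C1ᵀ * C1))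
    (O21 : A12ᵀ * diagonal s + diagonal t * A21 = -(C2ᵀ * C1))
    (hA : ∀ (v : ι → ℂ) (μ : ℂ), v ≠ 0 → A.map (algebraMap ℝ ℂ) *ᵥ v = μ • v →
      A21.map (algebraMap ℝ ℂ) *ᵥ v = 0 → μ.re < 0) : IsStable A := by
  intro μ hμ
  obtain ⟨v, h0, hv⟩ := (mem_spec _ _).1 hμ
  have a := mapC_eq _ _ _ _ _ _ R11
  have b := mapC_eq _ _ _ _ _ _ R21
  have c := mapC_eq _ _ _ _ _ _ O11
  have d := mapC_eq _ _ _ _ _ _ O21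
  simp only [mapC_conj, mapC_diag] at a b c d
  exact core _ _ _ _ _ _ _ s t hs ht hst a b c d v μ h0 hv (hA v μ h0 hv)

end Helpers

/-- Balanced truncation preserves asymptotic stability: if the balanced
realization satisfies `AΣ + ΣAᵀ = -BBᵀ`, `AᵀΣ + ΣA = -CᵀC` with `A` stable, the Hankel
singular values positive and ordered, and the truncated values are strictly separated from
the retained ones (`σ_r ≠ σ_{r+1}`), then both diagonal blocks `A₁₁, A₂₂` are stable. -/
theorem balanced_truncation_preserves_stability {r k m p : ℕ}
    (A₁₁ : Matrix (Fin r) (Fin r) ℝ) (A₁₂ : Matrix (Fin r) (Fin k) ℝ)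
    (A₂₁ : Matrix (Fin k) (Fin r) ℝ) (A₂₂ : Matrix (Fin k) (Fin k) ℝ)
    (B : Matrix (Fin r ⊕ Fin k) (Fin m) ℝ) (C : Matrix (Fin p) (Fin r ⊕ Fin k) ℝ)
    (σ₁ : Fin r → ℝ) (σ₂ : Fin k → ℝ)
    (hσ₁pos : ∀ i, 0 < σ₁ i) (hσ₂pos : ∀ j, 0 < σ₂ j)
    (hσ₁mono : Antitone σ₁) (hσ₂mono : Antitone σ₂)
    (hsep : ∀ i j, σ₂ j < σ₁ i)
    (hA : IsStable (Matrix.fromBlocks A₁₁ A₁₂ A₂₁ A₂₂))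
    (hreach : Matrix.fromBlocks A₁₁ A₁₂ A₂₁ A₂₂ * Matrix.diagonal (Sum.elim σ₁ σ₂) +
        Matrix.diagonal (Sum.elim σ₁ σ₂) * (Matrix.fromBlocks A₁₁ A₁₂ A₂₁ A₂₂)ᵀ = -(B * Bᵀ))
    (hobs : (Matrix.fromBlocks A₁₁ A₁₂ A₂₁ A₂₂)ᵀ * Matrix.diagonal (Sum.elim σ₁ σ₂) +
        Matrix.diagonal (Sum.elim σ₁ σ₂) * Matrix.fromBlocks A₁₁ A₁₂ A₂₁ A₂₂ = -(Cᵀ * C)) :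
    IsStable A₁₁ ∧ IsStable A₂₂ := by
  have hB : B = fromRows B.toRows₁ B.toRows₂ := (fromRows_toRows B).symm
  have hC : C = fromCols C.toCols₁ C.toCols₂ := (fromCols_toCols C).symm
  rw [hB] at hreach
  rw [hC] at hobs
  simp only [← fromBlocks_diagonal, fromBlocks_transpose, fromBlocks_multiply, fromBlocks_add,
    transpose_fromRows, transpose_fromCols, fromRows_mul_fromCols, fromBlocks_neg,
    fromBlocks_inj, Matrix.mul_zero, Matrix.zero_mul, add_zero, zero_add] at hreach hobs
  obtain ⟨R11, R12, R21, R22⟩ := hreach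
  obtain ⟨O11, O12, O21, O22⟩ := hobs
  constructor
  · refine coreR A₁₁ A₁₂ A₂₁ _ _ _ _ σ₁ σ₂ hσ₁pos hσ₂pos (fun i j => (hsep i j).ne')
      R11 R21 O11 O21 ?_
    intro v μ h0 hv h
    refine hA μ ((mem_spec _ _).2 ⟨Sum.elim v 0, ?_, ?_⟩)
    · intro h'
      exact h0 (funext fun i => congrFun h' (Sum.inl i))
    · rw [fromBlocks_map, fromBlocks_mulVec]
      simp only [Sum.elim_comp_inl, Sum.elim_comp_inr, hv, h, mulVec_zero, add_zero]
      funext i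
      rcases i with i | i <;> simp
  · refine coreR A₂₂ A₂₁ A₁₂ _ _ _ _ σ₂ σ₁ hσ₂pos hσ₁pos (fun i j => (hsep j i).ne)
      R22 R12 O22 O12 ?_
    intro v μ h0 hv h
    refine hA μ ((mem_spec _ _).2 ⟨Sum.elim 0 v, ?_, ?_⟩)
    · intro h'
      exact h0 (funext fun i => congrFun h' (Sum.inr i))
    · rw [fromBlocks_map, fromBlocks_mulVec]
      simp only [Sum.elim_comp_inl, Sum.elim_comp_inr, hv, h, mulVec_zero, zero_add]
      funext i
      rcases i with i | i <;> simp
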